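/- Let G be a group acting on a commutative unital ring A by ring automorphisms via σ : G → Aut(A). If the skew group algebra A ⋊^σ G is a simple ring, then the subring A u_e is maximal commutative in A ⋊^σ G. -/

import Mathlib

section SkewGroupRing

variable {A : Type*} [CommRing A] {G : Type*} {R : Type*} [Ring R] {ι : A →+* R} {u : G → R}

theorem skew_induction (e : (G →₀ A) ≃+ R)
    (he : ∀ g a, e (Finsupp.single g a) = ι a * u g) {P : R → Prop} (r : R)
    (h_zero : P 0) (h_add : ∀ x y, P x → P y → P (x + y))
    (h_monomial : ∀ a g, P (ι a * u g)) : P r := by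
  obtain ⟨x, rfl⟩ := e.surjective r
  induction x using Finsupp.induction_linear with
  | zero => simpa using h_zero
  | add x y hx hy => simpa using h_add _ _ hx hy
  | single g a => simpa [he] using h_monomial a g

theorem coeff_coe_mul (e : (G →₀ A) ≃+ R)
    (he : ∀ g a, e (Finsupp.single g a) = ι a * u g)
    (r : R) (a : A) (g : G) : e.symm (ι a * r) g = a * e.symm r g := by
  classical
  have he' (g : G) (a : A) : e.symm (ι a * u g) = Finsupp.single g a := by simp [← he]
  induction r using skew_induction e he with
  | h_zero => simp
  | h_add x y hx hy => simp [mul_add, hx, hy]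
  | h_monomial b h =>
    rw [← mul_assoc, ← map_mul, he', he']
    simp only [Finsupp.single_apply]
    split_ifs with hh <;> simp

/-- The largest two-sided ideal contained in the kernel of an additive map. -/
def AddMonoidHom.kerTwoSidedIdeal {M : Type*} [AddCommGroup M] (ε : R →+ M) :
    TwoSidedIdeal R :=
  .mk' {y | ∀ p q, ε (p * y * q) = 0} (by simp)
    (fun hx hy p q ↦ by simp [mul_add, add_mul, hx p q, hy p q])
    (fun hx p q ↦ by simp [hx p q])
    (fun {x y} hy p q ↦ by simpa [mul_assoc] using hy (p * x) q)
    (fun {x y} hx p q ↦ by simpa [mul_assoc] using hx p (y * q))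

theorem AddMonoidHom.mem_kerTwoSidedIdeal {M : Type*} [AddCommGroup M] {ε : R →+ M} {y : R} :
    y ∈ ε.kerTwoSidedIdeal ↔ ∀ p q, ε (p * y * q) = 0 := by
  simp [kerTwoSidedIdeal]

variable [Group G] {σ : G →* RingAut A}

theorem skew_monomial_mul (hu_mul : ∀ g h : G, u g * u h = u (g * h))
    (hu_comm : ∀ (g : G) (a : A), u g * ι a = ι (σ g a) * u g) (g h : G) (a b : A) :
    (ι a * u g) * (ι b * u h) = ι (a * σ g b) * u (g * h) := by
  rw [mul_assoc, ← mul_assoc (u g), hu_comm, mul_assoc, hu_mul, ← mul_assoc, ← map_mul]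

theorem coeff_mul_coe (hu_comm : ∀ (g : G) (a : A), u g * ι a = ι (σ g a) * u g)
    (e : (G →₀ A) ≃+ R) (he : ∀ g a, e (Finsupp.single g a) = ι a * u g)
    (r : R) (a : A) (g : G) : e.symm (r * ι a) g = e.symm r g * σ g a := by
  classical
  have he' (g : G) (a : A) : e.symm (ι a * u g) = Finsupp.single g a := by simp [← he]
  induction r using skew_induction e he with
  | h_zero => simp
  | h_add x y hx hy => simp [add_mul, hx, hy]
  | h_monomial b h =>
    rw [mul_assoc, hu_comm, ← mul_assoc, ← map_mul, he', he']
    simp only [Finsupp.single_apply]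
    split_ifs with hh <;> simp [hh]

/-- In a simple skew group ring, `a u_s` centralizes the coefficient ring only if `a = 0` or
`s = 1`: otherwise `a - a u_s` would generate an ideal on which the sum of coefficients
vanishes. -/
theorem eq_zero_of_mul_apply_eq (hu_mul : ∀ g h : G, u g * u h = u (g * h))
    (hu_comm : ∀ (g : G) (a : A), u g * ι a = ι (σ g a) * u g)
    (e : (G →₀ A) ≃+ R) (he : ∀ g a, e (Finsupp.single g a) = ι a * u g)
    (hsimple : IsSimpleRing R) {s : G} (hs : s ≠ 1) {a : A}
    (ha : ∀ b, a * σ s b = b * a) : a = 0 := by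
  classical
  have he' (g : G) (a : A) : e.symm (ι a * u g) = Finsupp.single g a := by simp [← he]
  let ε : R →+ A := (Finsupp.liftAddHom fun _ ↦ AddMonoidHom.id A).comp e.symm.toAddMonoidHom
  have hε (g : G) (b : A) : ε (ι b * u g) = b := by simp [ε, he']
  have hmem : ι a * u 1 - ι a * u s ∈ ε.kerTwoSidedIdeal := by
    rw [AddMonoidHom.mem_kerTwoSidedIdeal]
    intro p q
    induction p using skew_induction e he with
    | h_zero => simp
    | h_add x y hx hy => simp only [add_mul, map_add, hx, hy, add_zero]
    | h_monomial b g =>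
      induction q using skew_induction e he with
      | h_zero => simp
      | h_add x y hx hy => simp only [mul_add, map_add, hx, hy, add_zero]
      | h_monomial c h =>
        simp only [mul_sub, sub_mul, map_sub, skew_monomial_mul hu_mul hu_comm, hε]
        simp only [mul_one, map_mul, RingAut.mul_apply]
        rw [mul_assoc, mul_assoc, ← map_mul, ← map_mul, ha, mul_comm a c, sub_self]
  rcases hsimple.simple.eq_bot_or_eq_top ε.kerTwoSidedIdeal with h | h
  · rw [h, TwoSidedIdeal.mem_bot, sub_eq_zero] at hmem
    simpa [he', Finsupp.single_apply, hs] using DFunLike.congr_fun (congrArg e.symm hmem) 1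
  · have h_one : (1 : R) ∈ ε.kerTwoSidedIdeal := h ▸ trivial
    have := AddMonoidHom.mem_kerTwoSidedIdeal.1 h_one (ι a * u 1) 1
    simpa [hε] using this

end SkewGroupRing

/-- Let a group `G` act on a commutative unital ring `A` by ring
automorphisms via `σ : G →* RingAut A`. If the skew group algebra `A ⋊^σ G`
(modelled as a ring `R` with `ι : A →+* R`, elements `u g`, the skew commutation
relation and freeness) is a simple ring, then the subring `A u_e = range ι` is
maximal commutative in `A ⋊^σ G`. -/
theorem skew_group_algebra_simple_implies_maximal_commutative
    {A : Type*} [CommRing A] {G : Type*} [Group G] (σ : G →* RingAut A)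
    {R : Type*} [Ring R] (ι : A →+* R) (u : G → R)
    (hu_one : u 1 = 1)
    (hu_mul : ∀ g h : G, u g * u h = u (g * h))
    (hu_comm : ∀ (g : G) (a : A), u g * ι a = ι (σ g a) * u g)
    (hfree : Function.Bijective
      (fun x : G →₀ A => x.sum fun g a => ι a * u g))
    (hsimple : IsSimpleRing R) :
    {r : R | ∀ a : A, r * ι a = ι a * r} = Set.range ι := by
  classical
  let e : (G →₀ A) ≃+ R := AddEquiv.ofBijective
    (Finsupp.liftAddHom fun g ↦ (AddMonoidHom.mulRight (u g)).comp ι.toAddMonoidHom) hfree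
  have he (g : G) (a : A) : e (Finsupp.single g a) = ι a * u g := by simp [e]
  ext r
  constructor
  · intro hr
    have hcoeff (s : G) (hs : s ≠ 1) : e.symm r s = 0 :=
      eq_zero_of_mul_apply_eq hu_mul hu_comm e he hsimple hs fun b ↦ by
        rw [← coeff_mul_coe hu_comm e he, hr b, coeff_coe_mul e he]
    refine ⟨e.symm r 1, ?_⟩
    rw [← mul_one (ι _), ← hu_one, ← he, ← e.eq_symm_apply]
    ext s
    by_cases hs : s = 1
    · simp [hs]
    · simp [hcoeff s hs, Ne.symm hs]
  · rintro ⟨b, rfl⟩ a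
    rw [← map_mul, ← map_mul, mul_comm]
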